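/- Let R be a commutative noetherian ring and F : Mod_R → Mod_R an R-linear, half-exact functor which is finitely generated and preserves filtered colimits. If q is a prime ideal of R with F(κ(q)) = 0, then there exists r ∈ R ∖ q such that F vanishes identically on R_r-modules: F(N) = 0 for every R-module N admitting an R_r-module structure. -/

import Mathlib

open CategoryTheory CategoryTheory.Limits

universe u

variable {R : Type u} [CommRing R]

/-- A functor `F : Mod_R ⥤ Mod_R` is *finitely generated* if there are an `R`-module `I`
and an element `η ∈ F(I)` such that for every `R`-module `M` the map
`Hom_R(I, M) → F(M)`, `f ↦ F(f)(η)`, is surjective. -/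
def CategoryTheory.Functor.IsFinitelyGenerated (F : ModuleCat.{u} R ⥤ ModuleCat.{u} R) :
    Prop :=
  ∃ (I : ModuleCat.{u} R) (η : F.obj I),
    ∀ (M : ModuleCat.{u} R) (x : F.obj M), ∃ f : I ⟶ M, F.map f η = x

/-- The residue field `κ(q) = R_q/qR_q` at a prime ideal `q`, as an `R`-module. -/
noncomputable abbrev residueFieldAt (q : Ideal R) [q.IsPrime] : ModuleCat.{u} R :=
  ModuleCat.of R (IsLocalRing.ResidueField (Localization.AtPrime q))

namespace Stmt18Aux

variable {R : Type u} [CommRing R]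

/-- `F` vanishes on the module `M`. -/
def Z (F : ModuleCat.{u} R ⥤ ModuleCat.{u} R) (M : Type u) [AddCommGroup M] [Module R M] : Prop :=
  ∀ x : F.obj (ModuleCat.of R M), x = 0

/-- half-exactness -/
def HE (F : ModuleCat.{u} R ⥤ ModuleCat.{u} R) : Prop :=
  ∀ (M' M M'' : ModuleCat.{u} R) (f' : M' ⟶ M) (f : M ⟶ M''),
      Function.Injective f' → Function.Surjective f → Function.Exact f' f →
        Function.Exact (F.map f') (F.map f)

/-- The cocone of f.g. submodules. -/
noncomputable def fgCocone (M : Type u) [AddCommGroup M] [Module R M] :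
    Cocone (ModuleCat.directLimitDiagram _ (Module.fgSystem R M)) where
  pt := ModuleCat.of R M
  ι := { app := fun N => ModuleCat.ofHom N.1.subtype
         naturality := fun _ _ h => by
          ext
          rfl }

noncomputable def fgCoconeIsColimit (M : Type u) [AddCommGroup M] [Module R M] [DecidableEq (Submodule R M)] :
    IsColimit (fgCocone (R := R) M) :=
  IsColimit.ofIsoColimit (ModuleCat.directLimitIsColimit _ (Module.fgSystem R M))
    (Cocone.ext (Module.fgSystem.equiv R M).toModuleIso (fun N => by
      ext x
      exact LinearMap.congr_fun (Module.fgSystem.equiv_comp_of N) x))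

lemma exists_rep (F : ModuleCat.{u} R ⥤ ModuleCat.{u} R) [PreservesFilteredColimits F]
    (M : Type u) [AddCommGroup M] [Module R M] (x : F.obj (ModuleCat.of R M)) :
    ∃ (L : Submodule R M) (_ : L.FG) (y : F.obj (ModuleCat.of R L)),
      F.map (ModuleCat.ofHom L.subtype) y = x := by
  classical
  obtain ⟨L, y, h⟩ := Concrete.isColimit_exists_rep _
    (isColimitOfPreserves F (fgCoconeIsColimit (R := R) M)) x
  exact ⟨L.1, L.2, y, h⟩

lemma exists_zero (F : ModuleCat.{u} R ⥤ ModuleCat.{u} R) [PreservesFilteredColimits F]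
    (M : Type u) [AddCommGroup M] [Module R M] (L : Submodule R M) (hL : L.FG)
    (y : F.obj (ModuleCat.of R L)) (hy : F.map (ModuleCat.ofHom L.subtype) y = 0) :
    ∃ (L' : Submodule R M) (_ : L'.FG) (h : L ≤ L'),
      F.map (ModuleCat.ofHom (Submodule.inclusion h)) y = 0 := by
  classical
  let i : {N : Submodule R M // N.FG} := ⟨L, hL⟩
  obtain ⟨k, f, g, h⟩ := Concrete.isColimit_exists_of_rep_eq _
    (isColimitOfPreserves F (fgCoconeIsColimit (R := R) M)) (i := i) (j := i) y 0
    (hy.trans (map_zero (F.map (ModuleCat.ofHom L.subtype)).hom).symm)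
  refine ⟨k.1, k.2, leOfHom f, ?_⟩
  exact h.trans (map_zero (F.map (ModuleCat.ofHom (Submodule.inclusion (leOfHom g)))).hom)

variable (F : ModuleCat.{u} R ⥤ ModuleCat.{u} R)

lemma map_comp' {L M N : ModuleCat.{u} R} (f : L ⟶ M) (g : M ⟶ N) (x : F.obj L) :
    F.map (f ≫ g) x = F.map g (F.map f x) := by
  rw [F.map_comp]; rfl

lemma map_id' {L : ModuleCat.{u} R} (x : F.obj L) : F.map (𝟙 L) x = x := by
  rw [F.map_id]; rfl

variable {F}

lemma Z.of_equiv {M M' : Type u} [AddCommGroup M] [Module R M] [AddCommGroup M'] [Module R M']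
    (e : M ≃ₗ[R] M') (h : Z F M) : Z F M' := by
  intro x
  have h1 : ModuleCat.ofHom e.symm.toLinearMap ≫ ModuleCat.ofHom e.toLinearMap
    = 𝟙 (ModuleCat.of R M') := by
    ext; simp
  rw [← map_id' F x, ← h1, map_comp', h (F.map (ModuleCat.ofHom e.symm.toLinearMap) x)]
  exact map_zero (F.map _).hom

lemma Z.of_subsingleton [F.Additive] {M : Type u} [AddCommGroup M] [Module R M] [Subsingleton M] :
    Z F M := by
  intro x
  have h1 : 𝟙 (ModuleCat.of R M) = 0 := by
    ext; exact Subsingleton.elim _ _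
  rw [← map_id' F x, h1, F.map_zero]
  rfl

lemma Z.of_exact (hF : HE F) {M' M M'' : Type u} [AddCommGroup M] [Module R M]
    [AddCommGroup M'] [Module R M'] [AddCommGroup M''] [Module R M'']
    (f : M' →ₗ[R] M) (g : M →ₗ[R] M'') (hf : Function.Injective f) (hg : Function.Surjective g)
    (hfg : Function.Exact f g) (h : Z F M') (h'' : Z F M'') : Z F M := by
  intro x
  obtain ⟨y, rfl⟩ := (hF _ _ _ (ModuleCat.ofHom f) (ModuleCat.ofHom g) hf hg hfg x).1 (h'' _)
  rw [h y]
  exact map_zero (F.map _).hom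

variable {A : Type u} [CommRing A] [Algebra R A]

/-- Multiplication by `a`, as an `R`-linear map. -/
def mulMap (M : Type u) [AddCommGroup M] [Module R M] [Module A M] [IsScalarTower R A M]
    (a : A) : M →ₗ[R] M := (LinearMap.lsmul A M a).restrictScalars R

variable [IsNoetherianRing A] [IsLocalRing A]

lemma finite_hom (I M : Type u) [AddCommGroup I] [Module R I] [Module.Finite R I]
    [AddCommGroup M] [Module R M] [Module A M] [IsScalarTower R A M] [Module.Finite A M] :
    IsNoetherian A (I →ₗ[R] M) := by
  obtain ⟨n, p, hp⟩ := Module.Finite.exists_fin' R I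
  let φ : (I →ₗ[R] M) →ₗ[A] (Fin n → M) :=
    { toFun := fun f i => f (p (Pi.single i 1))
      map_add' := fun _ _ => rfl
      map_smul' := fun _ _ => rfl }
  refine isNoetherian_of_injective φ ?_
  intro f g h
  have : f.comp p = g.comp p := by
    ext i
    exact congr_fun h i
  ext x
  obtain ⟨y, rfl⟩ := hp x
  exact LinearMap.congr_fun this y

lemma Z.of_nakayama [F.Additive] (I : Type u) [AddCommGroup I] [Module R I] [Module.Finite R I]
    (η : F.obj (ModuleCat.of R I))
    (hη : ∀ (M : ModuleCat.{u} R) (x : F.obj M), ∃ f : ModuleCat.of R I ⟶ M, F.map f η = x)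
    (M : Type u) [AddCommGroup M] [Module R M] [Module A M] [IsScalarTower R A M]
    [Module.Finite A M] (a : A) (ha : a ∈ IsLocalRing.maximalIdeal A)
    (hs : Function.Surjective (F.map (ModuleCat.ofHom (mulMap (R := R) M a)))) : Z F M := by
  have := finite_hom (R := R) (A := A) I M
  let K : Submodule A (I →ₗ[R] M) :=
    { carrier := {f | F.map (ModuleCat.ofHom f) η = 0}
      zero_mem' := by
        change F.map (0 : ModuleCat.of R I ⟶ ModuleCat.of R M) η = 0
        rw [F.map_zero]; rfl
      add_mem' := by
        intro f g hf hg
        change F.map (ModuleCat.ofHom f + ModuleCat.ofHom g) η = 0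
        rw [F.map_add]
        change F.map (ModuleCat.ofHom f) η + F.map (ModuleCat.ofHom g) η = 0
        rw [hf, hg, add_zero]
      smul_mem' := by
        intro c f hf
        change F.map (ModuleCat.ofHom f ≫ ModuleCat.ofHom (mulMap (R := R) M c)) η = 0
        rw [map_comp', hf]
        exact map_zero (F.map _).hom }
  have hK : (⊤ : Submodule A (I →ₗ[R] M)) ≤ K := by
    refine Submodule.le_of_le_smul_of_le_jacobson_bot (I := IsLocalRing.maximalIdeal A)
      (IsNoetherian.noetherian _) (IsLocalRing.jacobson_eq_maximalIdeal _ bot_ne_top).ge ?_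
    intro f _
    obtain ⟨z, hz⟩ := hs (F.map (ModuleCat.ofHom f) η)
    obtain ⟨g, rfl⟩ := hη _ z
    have h1 : f - a • g.hom ∈ K := by
      change F.map (ModuleCat.ofHom f - g ≫ ModuleCat.ofHom (mulMap (R := R) M a)) η = 0
      rw [F.map_sub]
      change F.map (ModuleCat.ofHom f) η -
        F.map (g ≫ ModuleCat.ofHom (mulMap (R := R) M a)) η = 0
      rw [map_comp', hz, sub_self]
    have := Submodule.add_mem_sup h1
      (Submodule.smul_mem_smul ha (Submodule.mem_top (R := A) (x := g.hom)))
    rwa [sub_add_cancel] at this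
  intro x
  obtain ⟨f, rfl⟩ := hη _ x
  exact hK (Submodule.mem_top (x := f.hom))

lemma Z.quot [F.Additive] (hF : HE F) (I : Type u) [AddCommGroup I] [Module R I]
    [Module.Finite R I] (η : F.obj (ModuleCat.of R I))
    (hη : ∀ (M : ModuleCat.{u} R) (x : F.obj M), ∃ f : ModuleCat.of R I ⟶ M, F.map f η = x)
    (hm : Z F (A ⧸ IsLocalRing.maximalIdeal A)) (J : Ideal A) : Z F (A ⧸ J) := by
  induction J using WellFoundedGT.induction with
  | ind J ih =>
  by_cases hJm : J = IsLocalRing.maximalIdeal A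
  · subst hJm; exact hm
  by_cases hJt : J = ⊤
  · have : Subsingleton (A ⧸ J) := Ideal.Quotient.subsingleton_iff.2 hJt
    exact Z.of_subsingleton
  obtain ⟨x, hxm, hxJ⟩ : ∃ x ∈ IsLocalRing.maximalIdeal A, x ∉ J := by
    by_contra! h
    exact hJm (le_antisymm (IsLocalRing.le_maximalIdeal hJt) h)
  have key : ∀ y : A, y ∉ J → Z F (A ⧸ (J ⊔ Ideal.span {y})) := by
    intro y hy
    refine ih _ (lt_of_le_of_ne le_sup_left fun h => hy ?_)
    rw [h]
    exact Ideal.mem_sup_right (Ideal.mem_span_singleton_self y)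
  let K : Ideal A := LinearMap.ker ((Submodule.mkQ J).comp (LinearMap.lsmul A A x))
  have hK : ∀ c, c ∈ K ↔ x * c ∈ J := by
    intro c
    exact Submodule.Quotient.mk_eq_zero J
  have hJK : J ≤ K := fun c hc => (hK c).2 (J.mul_mem_left _ hc)
  let f : (A ⧸ K) →ₗ[A] (A ⧸ J) := Submodule.liftQ K
    ((Submodule.mkQ J).comp (LinearMap.lsmul A A x)) le_rfl
  have hf : Function.Injective f := by
    rw [← LinearMap.ker_eq_bot]
    exact Submodule.ker_liftQ_eq_bot _ _ _ le_rfl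
  let g : (A ⧸ J) →ₗ[A] (A ⧸ (J ⊔ Ideal.span {x})) := Submodule.factor le_sup_left
  have hg : Function.Surjective g := Submodule.factor_surjective le_sup_left
  have hfg : Function.Exact f g := by
    intro z
    obtain ⟨z, rfl⟩ := Submodule.mkQ_surjective _ z
    constructor
    · intro h
      have h : z ∈ J ⊔ Ideal.span {x} := (Submodule.Quotient.mk_eq_zero _).1 h
      obtain ⟨j, hj, w, hw, rfl⟩ := Submodule.mem_sup.1 h
      obtain ⟨c, rfl⟩ := Ideal.mem_span_singleton'.1 hw
      refine ⟨Submodule.mkQ K c, ?_⟩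
      refine (Submodule.Quotient.eq J).2 ?_
      have : x * c - (j + c * x) = -j := by ring
      change x * c - (j + c * x) ∈ J
      rw [this]
      exact J.neg_mem hj
    · rintro ⟨c, hc⟩
      obtain ⟨c, rfl⟩ := Submodule.mkQ_surjective _ c
      rw [← hc]
      refine (Submodule.Quotient.mk_eq_zero _).2 ?_
      exact Ideal.mem_sup_right (Ideal.mul_mem_right c _ (Ideal.mem_span_singleton_self x))
  by_cases hKJ : K = J
  · -- Nakayama
    refine Z.of_nakayama (A := A) I η hη (A ⧸ J) x hxm ?_
    let e : (A ⧸ J) ≃ₗ[A] (A ⧸ K) := Submodule.quotEquivOfEq _ _ hKJ.symm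
    have hfe : ∀ z, mulMap (R := R) (A ⧸ J) x z = f (e z) := by
      intro z
      obtain ⟨z, rfl⟩ := Submodule.mkQ_surjective _ z
      rfl
    have hfe' : ⇑(mulMap (R := R) (A ⧸ J) x) = f ∘ e := funext hfe
    have hex := hF _ _ _ (ModuleCat.ofHom (mulMap (R := R) (A ⧸ J) x))
      (ModuleCat.ofHom (g.restrictScalars R))
      (by change Function.Injective (mulMap (R := R) (A ⧸ J) x)
          rw [hfe']; exact hf.comp e.injective) hg
      (by change Function.Exact (mulMap (R := R) (A ⧸ J) x) g
          rw [hfe']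
          intro z
          rw [hfg z, Set.range_comp, e.surjective.range_eq, Set.image_univ])
    intro z
    exact (hex z).1 (key x hxJ _)
  · exact Z.of_exact hF (f.restrictScalars R) (g.restrictScalars R) hf hg hfg
      (ih K (lt_of_le_of_ne hJK (Ne.symm hKJ))) (key x hxJ)

lemma Z.of_finite [F.Additive] (hF : HE F) (h : ∀ J : Ideal A, Z F (A ⧸ J))
    (M : Type u) [AddCommGroup M] [Module A M] [Module.Finite A M] [iR : Module R M]
    [iT : IsScalarTower R A M] : Z F M := by
  revert iR iT
  refine IsNoetherianRing.induction_on_isQuotientEquivQuotientPrime (A := A) (M := M) inferInstance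
    (motive := fun M _ _ _ => ∀ [Module R M] [IsScalarTower R A M], Z F M) ?_ ?_ ?_
  · intro N _ _ _ _ _ _
    exact Z.of_subsingleton
  · intro N _ _ _ p e _ _
    exact Z.of_equiv (e.symm.restrictScalars R) (h p.1)
  · intro N₁ _ _ _ N₂ _ _ _ N₃ _ _ _ f g hf hg hfg h₁ h₃ _ _
    letI : Module R N₁ := Module.compHom N₁ (algebraMap R A)
    letI : Module R N₃ := Module.compHom N₃ (algebraMap R A)
    haveI : IsScalarTower R A N₁ := IsScalarTower.of_algebraMap_smul fun _ _ => rfl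
    haveI : IsScalarTower R A N₃ := IsScalarTower.of_algebraMap_smul fun _ _ => rfl
    exact Z.of_exact hF (f.restrictScalars R) (g.restrictScalars R) hf hg hfg h₁ h₃

/-- A common element of `S` moving a f.g. submodule of the localization into the image. -/
lemma exists_common (S : Submonoid R) {I : Type u} [AddCommGroup I] [Module R I]
    (L : Submodule R (LocalizedModule S I)) (hL : L.FG) :
    ∃ s ∈ S, ∀ l ∈ L, s • l ∈ LinearMap.range (LocalizedModule.mkLinearMap S I) := by
  induction L, hL using Submodule.fg_induction with
  | singleton x =>
    obtain ⟨⟨m, s⟩, h⟩ := IsLocalizedModule.surj S (LocalizedModule.mkLinearMap S I) x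
    refine ⟨s, s.2, fun l hl => ?_⟩
    obtain ⟨c, rfl⟩ := Submodule.mem_span_singleton.1 hl
    rw [smul_comm]
    exact Submodule.smul_mem _ _ ⟨m, h.symm⟩
  | sup L₁ L₂ _ _ h₁ h₂ =>
    obtain ⟨s, hs, h₁⟩ := h₁
    obtain ⟨t, ht, h₂⟩ := h₂
    refine ⟨s * t, S.mul_mem hs ht, fun l hl => ?_⟩
    obtain ⟨a, ha, b, hb, rfl⟩ := Submodule.mem_sup.1 hl
    rw [smul_add]
    refine add_mem ?_ ?_
    · rw [mul_comm, mul_smul]; exact Submodule.smul_mem _ _ (h₁ a ha)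
    · rw [mul_smul]; exact Submodule.smul_mem _ _ (h₂ b hb)

lemma exists_kill (S : Submonoid R) {I : Type u} [AddCommGroup I] [Module R I]
    (L : Submodule R I) (hL : L.FG)
    (hk : L ≤ LinearMap.ker (LocalizedModule.mkLinearMap S I)) :
    ∃ s ∈ S, ∀ l ∈ L, s • l = 0 := by
  induction L, hL using Submodule.fg_induction with
  | singleton x =>
    have := hk (Submodule.mem_span_singleton_self x)
    obtain ⟨s, hs⟩ := (IsLocalizedModule.eq_zero_iff S (LocalizedModule.mkLinearMap S I)).1 this
    refine ⟨s, s.2, fun l hl => ?_⟩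
    obtain ⟨c, rfl⟩ := Submodule.mem_span_singleton.1 hl
    rw [smul_comm]
    exact (congrArg (c • ·) hs).trans (smul_zero c)
  | sup L₁ L₂ _ _ h₁ h₂ =>
    obtain ⟨s, hs, h₁⟩ := h₁ (le_sup_left.trans hk)
    obtain ⟨t, ht, h₂⟩ := h₂ (le_sup_right.trans hk)
    refine ⟨s * t, S.mul_mem hs ht, fun l hl => ?_⟩
    obtain ⟨a, ha, b, hb, rfl⟩ := Submodule.mem_sup.1 hl
    rw [smul_add, mul_smul s t b, h₂ b hb, mul_comm, mul_smul, h₁ a ha]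
    simp

/-- The factorization. -/
lemma exists_factor (S : Submonoid R) {I : Type u} [AddCommGroup I] [Module R I]
    (L : Submodule R (LocalizedModule S I))
    (hL : LinearMap.range (LocalizedModule.mkLinearMap S I) ≤ L) (s t : R)
    (hs : ∀ l ∈ L, s • l ∈ LinearMap.range (LocalizedModule.mkLinearMap S I))
    (ht : ∀ l ∈ LinearMap.ker (LocalizedModule.mkLinearMap S I), t • l = 0)
    (N : Type u) [AddCommGroup N] [Module R N]
    (hN : Function.Bijective (fun n : N => (s * t) • n)) (f : I →ₗ[R] N) :
    ∃ g : L →ₗ[R] N, ∀ i : I, g ⟨LocalizedModule.mkLinearMap S I i, hL ⟨i, rfl⟩⟩ = f i := by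
  let φ := LocalizedModule.mkLinearMap S I
  have hkf : LinearMap.ker φ ≤ LinearMap.ker f := by
    intro k hk
    apply hN.1
    change (s * t) • f k = (s * t) • 0
    rw [← map_smul, mul_smul, ht k hk, smul_zero, map_zero, smul_zero]
  let e := φ.quotKerEquivRange
  let f' : LinearMap.range φ →ₗ[R] N := (Submodule.liftQ _ f hkf).comp e.symm.toLinearMap
  have hf' : ∀ i : I, f' ⟨φ i, ⟨i, rfl⟩⟩ = f i := by
    intro i
    have : e.symm ⟨φ i, ⟨i, rfl⟩⟩ = Submodule.mkQ _ i := by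
      rw [LinearEquiv.symm_apply_eq]; rfl
    simp [f', this]
  let ν : N ≃ₗ[R] N := LinearEquiv.ofBijective (LinearMap.lsmul R N (s * t)) hN
  let m : L →ₗ[R] LinearMap.range φ :=
    ((LinearMap.lsmul R _ (s * t)).comp L.subtype).codRestrict _ (fun l => by
      change (s * t) • (l : LocalizedModule S I) ∈ _
      rw [mul_comm, mul_smul]
      exact Submodule.smul_mem _ _ (hs l.1 l.2))
  refine ⟨ν.symm.toLinearMap.comp (f'.comp m), fun i => ?_⟩
  change ν.symm (f' (m _)) = f i
  rw [LinearEquiv.symm_apply_eq]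
  have : m ⟨φ i, hL ⟨i, rfl⟩⟩ = (s * t) • (⟨φ i, ⟨i, rfl⟩⟩ : LinearMap.range φ) := rfl
  rw [this, map_smul, hf']
  rfl

end Stmt18Aux

/-- Let `R` be a commutative noetherian ring and `F : Mod_R → Mod_R` an `R`-linear,
half-exact functor which is finitely generated and preserves filtered colimits.  If `q`
is a prime ideal of `R` with `F(κ(q)) = 0`, then there exists `r ∈ R ∖ q` such that `F`
vanishes on every `R`-module admitting an `R_r`-module structure (i.e. on which `r` acts
invertibly). -/
theorem stmt18 (R : Type u) [CommRing R] [IsNoetherianRing R]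
    (F : ModuleCat.{u} R ⥤ ModuleCat.{u} R) [F.Additive] [F.Linear R]
    [PreservesFilteredColimits F] (hfg : F.IsFinitelyGenerated)
    (hhe : ∀ (M' M M'' : ModuleCat.{u} R) (f' : M' ⟶ M) (f : M ⟶ M''),
      Function.Injective f' → Function.Surjective f → Function.Exact f' f →
        Function.Exact (F.map f') (F.map f))
    (q : Ideal R) [q.IsPrime]
    (hq : ∀ x : F.obj (residueFieldAt q), x = 0) :
    ∃ r ∉ q, ∀ N : ModuleCat.{u} R,
      Function.Bijective (fun n : N => r • n) → ∀ x : F.obj N, x = 0 := by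
  obtain ⟨I₀, η₀, h₀⟩ := hfg
  obtain ⟨I, hI, η, hη₀⟩ := Stmt18Aux.exists_rep F I₀ η₀
  have hη : ∀ (M : ModuleCat.{u} R) (x : F.obj M),
      ∃ f : ModuleCat.of R I ⟶ M, F.map f η = x := by
    intro M x
    obtain ⟨f, rfl⟩ := h₀ M x
    refine ⟨ModuleCat.ofHom I.subtype ≫ f, ?_⟩
    rw [Stmt18Aux.map_comp']
    exact congrArg (F.map f) hη₀
  haveI : Module.Finite R I := Module.Finite.iff_fg.2 hI
  have hJ := Stmt18Aux.Z.quot (A := Localization.AtPrime q) hhe I η hη hq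
  haveI : IsNoetherianRing (Localization.AtPrime q) := inferInstance
  have hIq : Stmt18Aux.Z F (LocalizedModule q.primeCompl I) :=
    Stmt18Aux.Z.of_finite (A := Localization.AtPrime q) hhe hJ _
  let φ := LocalizedModule.mkLinearMap q.primeCompl I
  obtain ⟨L, hL, hle, h0⟩ := Stmt18Aux.exists_zero F (LocalizedModule q.primeCompl I)
    (LinearMap.range φ) (Module.Finite.iff_fg.1 inferInstance)
    (F.map (ModuleCat.ofHom φ.rangeRestrict) η) (hIq _)
  obtain ⟨s, hs, hs'⟩ := Stmt18Aux.exists_common q.primeCompl L hL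
  obtain ⟨t, ht, ht'⟩ := Stmt18Aux.exists_kill q.primeCompl (LinearMap.ker φ)
    (IsNoetherian.noetherian _) le_rfl
  refine ⟨s * t, q.primeCompl.mul_mem hs ht, fun N hN x => ?_⟩
  obtain ⟨f, rfl⟩ := hη N x
  obtain ⟨g, hg⟩ := Stmt18Aux.exists_factor q.primeCompl L hle s t hs' ht' N hN f.hom
  have hfg : f = (ModuleCat.ofHom (X := I) (Y := LinearMap.range φ) φ.rangeRestrict ≫
      ModuleCat.ofHom (X := LinearMap.range φ) (Y := L) (Submodule.inclusion hle)) ≫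
      ModuleCat.ofHom g := by
    ext i
    exact (hg i).symm
  rw [hfg, Stmt18Aux.map_comp', Stmt18Aux.map_comp', h0]
  exact map_zero (F.map _).hom
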